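/- arXiv:2603.10321 — 6 statements merged into one kernel-verified Lean document; each statement's English description precedes it below -/
import Mathlib

section
/- Let U be a compact subset of ℝ^ℓ with Leb(U) > 0, let K ≥ 0, and let g, g' : U → ℝ be measurable with |g(a)| ≤ K and |g'(a)| ≤ K for all a ∈ U. Then sup_{a∈U} |π_g(a) − π_{g'}(a)| ≤ (2 exp(4K)/Leb(U)) · sup_{a∈U} |g(a) − g'(a)|. -/
open MeasureTheory Real

lemma exp_lip_aux (K x y : ℝ) (hx : |x| ≤ K) (hy : |y| ≤ K) :
    |Real.exp x - Real.exp y| ≤ Real.exp K * |x - y| := by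
  have key : ∀ x y : ℝ, |x| ≤ K → Real.exp x - Real.exp y ≤ Real.exp K * |x - y| := by
    intro x y hx
    have h1 : Real.exp y = Real.exp x * Real.exp (y - x) := by
      rw [← Real.exp_add]; congr 1; ring
    have h2 := Real.add_one_le_exp (y - x)
    have h3 : Real.exp x ≤ Real.exp K := Real.exp_le_exp.2 ((le_abs_self x).trans hx)
    have h4 := Real.exp_pos x
    calc Real.exp x - Real.exp y ≤ Real.exp x * (x - y) := by rw [h1]; nlinarith
      _ ≤ Real.exp x * |x - y| := by gcongr; exact le_abs_self _
      _ ≤ _ := by gcongr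
  rw [abs_le]
  have h1 := key x y hx
  have h2 := key y x hy
  rw [abs_sub_comm y x] at h2
  constructor <;> linarith

/-- Sup-norm stability of the Gibbs map with explicit constant: if `|g|, |g'| ≤ K` on `U`, then
`sup_{a∈U} |π_g(a) − π_{g'}(a)| ≤ (2 exp(4K)/Leb(U)) · sup_{a∈U} |g(a) − g'(a)|`. -/
theorem gibbs_density_sup_stability
    {ℓ : ℕ} (hℓ : 1 ≤ ℓ)
    (U : Set (EuclideanSpace ℝ (Fin ℓ)))
    (hUcomp : IsCompact U) (hUpos : 0 < volume U)
    (K : ℝ) (hK : 0 ≤ K)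
    (g g' : EuclideanSpace ℝ (Fin ℓ) → ℝ)
    (hgmeas : Measurable g) (hg'meas : Measurable g')
    (hgbdd : ∀ a ∈ U, |g a| ≤ K)
    (hg'bdd : ∀ a ∈ U, |g' a| ≤ K)
    (πg πg' : EuclideanSpace ℝ (Fin ℓ) → ℝ)
    (hπg : πg = fun a => Real.exp (g a) / ∫ a' in U, Real.exp (g a'))
    (hπg' : πg' = fun a => Real.exp (g' a) / ∫ a' in U, Real.exp (g' a')) :
    sSup ((fun a => |πg a - πg' a|) '' U)
      ≤ (2 * Real.exp (4 * K) / (volume U).toReal) * sSup ((fun a => |g a - g' a|) '' U) := by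
  subst hπg hπg'
  have hfin : volume U < ⊤ := hUcomp.measure_lt_top
  have hUm : MeasurableSet U := hUcomp.measurableSet
  set V : ℝ := (volume U).toReal with hV
  have hVpos : 0 < V := ENNReal.toReal_pos hUpos.ne' hfin.ne
  set D : ℝ := sSup ((fun a => |g a - g' a|) '' U) with hD
  have hbdd : BddAbove ((fun a => |g a - g' a|) '' U) := by
    refine ⟨2 * K, ?_⟩
    rintro _ ⟨a, ha, rfl⟩
    have h1 := hgbdd a ha
    have h2 := hg'bdd a ha
    have h3 := abs_sub (g a) (g' a)
    simp only
    linarith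
  have hle : ∀ a ∈ U, |g a - g' a| ≤ D := fun a ha => le_csSup hbdd ⟨a, ha, rfl⟩
  have hne : U.Nonempty := nonempty_of_measure_ne_zero hUpos.ne'
  have hD0 : 0 ≤ D := by
    obtain ⟨a, ha⟩ := hne
    exact (abs_nonneg _).trans (hle a ha)
  have hup : ∀ f : EuclideanSpace ℝ (Fin ℓ) → ℝ, (∀ a ∈ U, |f a| ≤ K) → ∀ a ∈ U,
      Real.exp (f a) ≤ Real.exp K := fun f hf a ha =>
    Real.exp_le_exp.2 ((le_abs_self _).trans (hf a ha))
  have hint : ∀ f : EuclideanSpace ℝ (Fin ℓ) → ℝ, Measurable f → (∀ a ∈ U, |f a| ≤ K) →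
      IntegrableOn (fun a => Real.exp (f a)) U := by
    intro f hf hb
    refine Measure.integrableOn_of_bounded (M := Real.exp K) hfin.ne
      (Real.measurable_exp.comp hf).aestronglyMeasurable ?_
    refine (ae_restrict_iff' hUm).2 (Filter.Eventually.of_forall fun a ha => ?_)
    rw [Real.norm_eq_abs, abs_of_pos (Real.exp_pos _)]
    exact hup f hb a ha
  have hconst : ∀ c : ℝ, ∫ _ in U, c = c * V := by
    intro c
    rw [setIntegral_const, smul_eq_mul, mul_comm]; rfl
  have hcint : ∀ c : ℝ, IntegrableOn (fun _ : EuclideanSpace ℝ (Fin ℓ) => c) U := fun c =>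
    integrableOn_const hfin.ne
  have hZlow : ∀ f : EuclideanSpace ℝ (Fin ℓ) → ℝ, Measurable f → (∀ a ∈ U, |f a| ≤ K) →
      Real.exp (-K) * V ≤ ∫ a in U, Real.exp (f a) := by
    intro f hf hb
    rw [← hconst]
    exact setIntegral_mono_on (hcint _) (hint f hf hb) hUm fun a ha =>
      Real.exp_le_exp.2 (abs_le.1 (hb a ha)).1
  have hZup : ∀ f : EuclideanSpace ℝ (Fin ℓ) → ℝ, Measurable f → (∀ a ∈ U, |f a| ≤ K) →
      ∫ a in U, Real.exp (f a) ≤ Real.exp K * V := by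
    intro f hf hb
    rw [← hconst]
    exact setIntegral_mono_on (hint f hf hb) (hcint _) hUm (hup f hb)
  have hlip : ∀ a ∈ U, |Real.exp (g a) - Real.exp (g' a)| ≤ Real.exp K * D := fun a ha =>
    (exp_lip_aux K _ _ (hgbdd a ha) (hg'bdd a ha)).trans
      (mul_le_mul_of_nonneg_left (hle a ha) (Real.exp_pos K).le)
  have hZdiff : |(∫ a in U, Real.exp (g' a)) - ∫ a in U, Real.exp (g a)|
      ≤ Real.exp K * D * V := by
    rw [← integral_sub (hint g' hg'meas hg'bdd) (hint g hgmeas hgbdd)]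
    refine norm_setIntegral_le_of_norm_le_const (C := Real.exp K * D)
      (f := fun a => Real.exp (g' a) - Real.exp (g a)) hfin fun a ha => ?_
    rw [Real.norm_eq_abs, abs_sub_comm]
    exact hlip a ha
  have l1 := hZlow g hgmeas hgbdd
  have l2 := hZlow g' hg'meas hg'bdd
  have u1 := hZup g hgmeas hgbdd
  set Z := ∫ a in U, Real.exp (g a)
  set Z' := ∫ a in U, Real.exp (g' a)
  have hm : 0 < Real.exp (-K) * V := by positivity
  have hZ : 0 < Z := hm.trans_le l1
  have hZ' : 0 < Z' := hm.trans_le l2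
  refine csSup_le (hne.image _) ?_
  rintro _ ⟨a, ha, rfl⟩
  simp only
  have e1 : Real.exp (g a) / Z - Real.exp (g' a) / Z'
      = (Real.exp (g a) * (Z' - Z) + Z * (Real.exp (g a) - Real.exp (g' a))) / (Z * Z') := by
    field_simp
    ring
  have e2 : |Real.exp (g a) * (Z' - Z) + Z * (Real.exp (g a) - Real.exp (g' a))|
      ≤ Real.exp K * (Real.exp K * D * V) + Real.exp K * V * (Real.exp K * D) := by
    refine (abs_add_le _ _).trans ?_
    rw [abs_mul, abs_mul, abs_of_pos (Real.exp_pos _), abs_of_pos hZ]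
    have := hup g hgbdd a ha
    have := hlip a ha
    gcongr
  have e3 : (Real.exp (-K) * V) * (Real.exp (-K) * V) ≤ Z * Z' := by gcongr
  rw [e1, abs_div, abs_of_pos (mul_pos hZ hZ')]
  calc _ ≤ (Real.exp K * (Real.exp K * D * V) + Real.exp K * V * (Real.exp K * D)) /
        ((Real.exp (-K) * V) * (Real.exp (-K) * V)) := by gcongr
    _ = _ := by
      have h4 : Real.exp (4 * K) = Real.exp K ^ 4 := by
        rw [← Real.exp_nat_mul]; norm_num
      rw [h4, Real.exp_neg]
      have := Real.exp_pos K
      field_simp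
      ring
end

section
/- Let U be a compact subset of ℝ^ℓ with Leb(U) > 0, let K ≥ 0, and let g, g' : U → ℝ be measurable with |g(a)| ≤ K and |g'(a)| ≤ K for all a ∈ U. Then the entropies of the Gibbs densities satisfy |𝓗(π_g) − 𝓗(π_{g'})| ≤ (2K·exp(4K) + 2) · sup_{a∈U} |g(a) − g'(a)|. -/
open MeasureTheory Real

/-- The differential (Shannon) entropy of a density `ϖ` on a set `U`,
`𝓗(ϖ) = -∫_U ϖ(a) ln ϖ(a) da` (with the convention `0 · ln 0 = 0`). -/
noncomputable def shannonEntropy {E : Type*} [MeasureSpace E] (U : Set E) (ϖ : E → ℝ) : ℝ :=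
  -∫ a in U, ϖ a * Real.log (ϖ a)

lemma gibbs_exp_diff {x y M : ℝ} (hx : exp x ≤ M) (hy : exp y ≤ M) :
    |exp x - exp y| ≤ M * |x - y| := by
  have key : ∀ u v : ℝ, exp u ≤ M → exp u - exp v ≤ M * |u - v| := by
    intro u v hu
    have h1 : v - u + 1 ≤ exp (v - u) := add_one_le_exp _
    have h2 : exp v = exp u * exp (v - u) := by rw [← exp_add]; congr 1; ring
    have h3 : exp u * (v - u + 1) ≤ exp u * exp (v - u) :=
      mul_le_mul_of_nonneg_left h1 (exp_pos u).le
    have h4 : exp u * (u - v) ≤ exp u * |u - v| :=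
      mul_le_mul_of_nonneg_left (le_abs_self _) (exp_pos u).le
    have h5 : exp u * |u - v| ≤ M * |u - v| := mul_le_mul_of_nonneg_right hu (abs_nonneg _)
    rw [h2]; linarith
  rw [abs_le]
  have a := key x y hx
  have b := key y x hy
  rw [abs_sub_comm] at b
  constructor <;> linarith

lemma gibbs_core {α : Type*} [MeasurableSpace α] (μ : Measure α) [IsFiniteMeasure μ]
    (hμ : 0 < μ.real Set.univ) (K δ : ℝ) (hK : 0 ≤ K) (g g' : α → ℝ)
    (hgm : Measurable g) (hgm' : Measurable g')
    (hg : ∀ᵐ a ∂μ, |g a| ≤ K) (hg' : ∀ᵐ a ∂μ, |g' a| ≤ K)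
    (hd : ∀ᵐ a ∂μ, |g a - g' a| ≤ δ) (hδ : 0 ≤ δ) :
    |(∫ a, (exp (g a) / ∫ b, exp (g b) ∂μ) * log (exp (g a) / ∫ b, exp (g b) ∂μ) ∂μ)
      - ∫ a, (exp (g' a) / ∫ b, exp (g' b) ∂μ) * log (exp (g' a) / ∫ b, exp (g' b) ∂μ) ∂μ|
      ≤ (2 * K * exp (2 * K) + 2) * δ := by
  have int_exp : ∀ f : α → ℝ, Measurable f → (∀ᵐ a ∂μ, |f a| ≤ K) →
      Integrable (fun a => exp (f a)) μ := by
    intro f hf hb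
    refine Integrable.of_bound (by fun_prop) (exp K) ?_
    filter_upwards [hb] with a ha
    rw [Real.norm_eq_abs, abs_of_pos (exp_pos _)]
    exact exp_le_exp.2 (abs_le.1 ha).2
  have Zlow : ∀ f : α → ℝ, Measurable f → (∀ᵐ a ∂μ, |f a| ≤ K) →
      exp (-K) * μ.real Set.univ ≤ ∫ b, exp (f b) ∂μ := by
    intro f hf hb
    have : ∫ _, exp (-K) ∂μ ≤ ∫ b, exp (f b) ∂μ := by
      refine integral_mono_ae (integrable_const _) (int_exp f hf hb) ?_
      filter_upwards [hb] with a ha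
      exact exp_le_exp.2 (abs_le.1 ha).1
    rw [integral_const, smul_eq_mul, mul_comm] at this
    exact this
  have Zcmp : ∀ f f' : α → ℝ, Measurable f → Measurable f' → (∀ᵐ a ∂μ, |f a| ≤ K) →
      (∀ᵐ a ∂μ, |f' a| ≤ K) → (∀ᵐ a ∂μ, |f a - f' a| ≤ δ) →
      log (∫ b, exp (f b) ∂μ) - log (∫ b, exp (f' b) ∂μ) ≤ δ := by
    intro f f' hf hf' hb hb' hd
    have h1 : ∫ b, exp (f b) ∂μ ≤ ∫ b, exp δ * exp (f' b) ∂μ := by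
      refine integral_mono_ae (int_exp f hf hb) ((int_exp f' hf' hb').const_mul _) ?_
      filter_upwards [hd] with a ha
      rw [← exp_add]
      exact exp_le_exp.2 (by linarith [(abs_le.1 ha).2])
    rw [integral_const_mul] at h1
    have p1 := lt_of_lt_of_le (by positivity) (Zlow f hf hb)
    have p2 := lt_of_lt_of_le (by positivity) (Zlow f' hf' hb')
    have := log_le_log p1 h1
    rw [log_mul (exp_pos _).ne' p2.ne', log_exp] at this
    linarith
  have hL1 := Zcmp g g' hgm hgm' hg hg' hd
  have hL2 := Zcmp g' g hgm' hgm hg' hg (by simpa only [abs_sub_comm] using hd)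
  have hZ := Zlow g hgm hg
  have hZ' := Zlow g' hgm' hg'
  have iE := int_exp g hgm hg
  have iE' := int_exp g' hgm' hg'
  set V := μ.real Set.univ with hV
  set Z := ∫ b, exp (g b) ∂μ with hZd
  set Z' := ∫ b, exp (g' b) ∂μ with hZd'
  have pZ : 0 < Z := lt_of_lt_of_le (by positivity) hZ
  have pZ' : 0 < Z' := lt_of_lt_of_le (by positivity) hZ'
  have bd : ∀ (x z : ℝ), |x| ≤ K → exp (-K) * V ≤ z → exp (x - log z) ≤ exp (2 * K) / V := by
    intro x z hx hz
    have h := log_le_log (by positivity) hz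
    rw [log_mul (exp_pos _).ne' hμ.ne', log_exp] at h
    have : exp (2 * K) / V = exp (2 * K - log V) := by rw [exp_sub, exp_log hμ]
    rw [this]
    exact exp_le_exp.2 (by linarith [(abs_le.1 hx).2])
  have eq1 : ∀ x z : ℝ, 0 < z → exp x / z = exp (x - log z) := by
    intro x z hz; rw [exp_sub, exp_log hz]
  have mass : ∫ a, exp (g a - log Z) ∂μ = 1 := by
    simp_rw [← eq1 _ Z pZ]
    rw [integral_div, ← hZd, div_self pZ.ne']
  have mass' : ∫ a, exp (g' a - log Z') ∂μ = 1 := by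
    simp_rw [← eq1 _ Z' pZ']
    rw [integral_div, ← hZd', div_self pZ'.ne']
  have ip : Integrable (fun a => exp (g a - log Z)) μ := by
    simp_rw [← eq1 _ Z pZ]; exact iE.div_const _
  have ip' : Integrable (fun a => exp (g' a - log Z')) μ := by
    simp_rw [← eq1 _ Z' pZ']; exact iE'.div_const _
  simp_rw [eq1 _ Z pZ, eq1 _ Z' pZ', log_exp]
  have iF : Integrable (fun a => exp (g a - log Z) * (g a - log Z)) μ := by
    refine ip.mul_bdd (c := K + |log Z|) (by fun_prop) ?_
    filter_upwards [hg] with a ha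
    rw [Real.norm_eq_abs]
    exact (abs_sub _ _).trans (by linarith)
  have iF' : Integrable (fun a => exp (g' a - log Z') * (g' a - log Z')) μ := by
    refine ip'.mul_bdd (c := K + |log Z'|) (by fun_prop) ?_
    filter_upwards [hg'] with a ha
    rw [Real.norm_eq_abs]
    exact (abs_sub _ _).trans (by linarith)
  have e0 : ∫ a, log Z' * (exp (g a - log Z) - exp (g' a - log Z')) ∂μ = 0 := by
    rw [integral_const_mul, integral_sub ip ip', mass, mass']; ring
  have e1 : (∫ a, exp (g a - log Z) * (g a - log Z) ∂μ)
      - ∫ a, exp (g' a - log Z') * (g' a - log Z') ∂μ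
      = ∫ a, (exp (g a - log Z) * ((g a - g' a) - (log Z - log Z'))
        + (exp (g a - log Z) - exp (g' a - log Z')) * g' a) ∂μ := by
    rw [← integral_sub iF iF', ← add_zero (∫ a, _ ∂μ), ← e0]
    refine (integral_add (iF.sub iF') ((ip.sub ip').const_mul (log Z'))).symm.trans ?_
    congr 1
    ext a
    simp only [Pi.sub_apply]
    ring
  rw [e1, ← Real.norm_eq_abs]
  have e2 : ∫ a, (exp (g a - log Z) * (2 * δ) + exp (2 * K) / V * (2 * δ) * K) ∂μ
      = (2 * K * exp (2 * K) + 2) * δ := by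
    rw [integral_add (ip.mul_const _) (integrable_const _), integral_mul_const, mass,
      integral_const, smul_eq_mul, ← hV]
    field_simp
    ring
  rw [← e2]
  refine norm_integral_le_of_norm_le ((ip.mul_const _).add (integrable_const _)) ?_
  filter_upwards [hg, hg', hd] with a h1 h2 h3
  have hh : |(g a - g' a) - (log Z - log Z')| ≤ 2 * δ := by
    have := abs_le.1 h3
    rw [abs_le]; constructor <;> linarith
  rw [Real.norm_eq_abs]
  refine (abs_add_le _ _).trans (add_le_add ?_ ?_)
  · rw [abs_mul, abs_of_pos (exp_pos _)]
    exact mul_le_mul_of_nonneg_left hh (exp_pos _).le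
  · rw [abs_mul]
    refine mul_le_mul ?_ h2 (abs_nonneg _) (by positivity)
    refine (gibbs_exp_diff (bd _ _ h1 hZ) (bd _ _ h2 hZ')).trans ?_
    refine mul_le_mul_of_nonneg_left ?_ (by positivity)
    rw [show g a - log Z - (g' a - log Z') = (g a - g' a) - (log Z - log Z') by ring]
    exact hh

/-- Lipschitz stability of the entropy of the Gibbs density in the exponent:
if `|g|, |g'| ≤ K` on `U`, then
`|𝓗(π_g) − 𝓗(π_{g'})| ≤ (2K e^{4K} + 2) · sup_{a∈U} |g(a) − g'(a)|`. -/
theorem gibbs_density_entropy_stability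
    {ℓ : ℕ} (hℓ : 1 ≤ ℓ)
    (U : Set (EuclideanSpace ℝ (Fin ℓ)))
    (hUcomp : IsCompact U) (hUpos : 0 < volume U)
    (K : ℝ) (hK : 0 ≤ K)
    (g g' : EuclideanSpace ℝ (Fin ℓ) → ℝ)
    (hgmeas : Measurable g) (hg'meas : Measurable g')
    (hgbdd : ∀ a ∈ U, |g a| ≤ K)
    (hg'bdd : ∀ a ∈ U, |g' a| ≤ K)
    (πg πg' : EuclideanSpace ℝ (Fin ℓ) → ℝ)
    (hπg : πg = fun a => Real.exp (g a) / ∫ a' in U, Real.exp (g a'))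
    (hπg' : πg' = fun a => Real.exp (g' a) / ∫ a' in U, Real.exp (g' a')) :
    |shannonEntropy U πg - shannonEntropy U πg'|
      ≤ (2 * K * Real.exp (4 * K) + 2) * sSup ((fun a => |g a - g' a|) '' U) := by
  have hfin : volume U ≠ ⊤ := hUcomp.measure_lt_top.ne
  have : IsFiniteMeasure (volume.restrict U) := ⟨by simpa using hfin.lt_top⟩
  have hUm := hUcomp.measurableSet
  have hbdd : BddAbove ((fun a => |g a - g' a|) '' U) := by
    refine ⟨K + K, ?_⟩
    rintro _ ⟨a, ha, rfl⟩
    exact (abs_sub _ _).trans (add_le_add (hgbdd a ha) (hg'bdd a ha))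
  have hδ : 0 ≤ sSup ((fun a => |g a - g' a|) '' U) := by
    apply Real.sSup_nonneg
    rintro _ ⟨a, ha, rfl⟩
    exact abs_nonneg _
  have core := gibbs_core (volume.restrict U)
    (by rw [measureReal_restrict_apply_univ]; exact ENNReal.toReal_pos hUpos.ne' hfin)
    K _ hK g g' hgmeas hg'meas
    (ae_restrict_of_forall_mem hUm hgbdd) (ae_restrict_of_forall_mem hUm hg'bdd)
    (ae_restrict_of_forall_mem hUm fun a ha => le_csSup hbdd ⟨a, ha, rfl⟩) hδ
  subst hπg hπg'
  unfold shannonEntropy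
  rw [neg_sub_neg, abs_sub_comm]
  refine core.trans (mul_le_mul_of_nonneg_right ?_ hδ)
  have : Real.exp (2 * K) ≤ Real.exp (4 * K) := Real.exp_le_exp.2 (by linarith)
  have := mul_le_mul_of_nonneg_left this (by linarith : 0 ≤ 2 * K)
  linarith
end

section
/- (Quantitative Laplace bounds under the cone condition.) Let U ⊂ ℝ^ℓ be compact with Leb(U) > 0, satisfying the uniform inner-cone condition with parameters ζ > 0 and γ ∈ (0, π/2), and set c := Leb(Δ_γ ∩ B_1(0)). Let g : U → ℝ be Lipschitz with constant L ≥ 0 and let λ > 0. Then max_{a∈U} g(a) − L·r + λ·ln(c·r^ℓ) ≤ λ · ln( ∫_U exp(g(a)/λ) da ) ≤ max_{a∈U} g(a) + λ·ln Leb(U) for every 0 < r ≤ ζ. -/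
open MeasureTheory Real

/-- The cone `Δ_γ = {u ∈ ℝ^{ℓ+1} : u_1² + ⋯ + u_ℓ² ≤ tan(γ) u_{ℓ+1}², u_{ℓ+1} ≥ 0}`
(the dimension is `ℓ + 1 ≥ 1`). -/
def coneDelta (ℓ : ℕ) (γ : ℝ) : Set (EuclideanSpace ℝ (Fin (ℓ + 1))) :=
  {u | (∑ i ∈ Finset.univ.erase (Fin.last ℓ), (u i) ^ 2)
        ≤ Real.tan γ * (u (Fin.last ℓ)) ^ 2 ∧ 0 ≤ u (Fin.last ℓ)}

/-- `U` satisfies the uniform inner-cone condition with parameters `ζ > 0` and `γ`. -/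
def UniformInnerCone (ℓ : ℕ) (U : Set (EuclideanSpace ℝ (Fin (ℓ + 1)))) (ζ γ : ℝ) : Prop :=
  ∀ a ∈ U, ∃ O : EuclideanSpace ℝ (Fin (ℓ + 1)) ≃ₗᵢ[ℝ] EuclideanSpace ℝ (Fin (ℓ + 1)),
    (fun u => a + O u) '' (coneDelta ℓ γ ∩ Metric.closedBall 0 ζ) ⊆ U

lemma coneDelta_isClosed (ℓ : ℕ) (γ : ℝ) : IsClosed (coneDelta ℓ γ) := by
  have h1 : IsClosed {u : EuclideanSpace ℝ (Fin (ℓ + 1)) |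
      (∑ i ∈ Finset.univ.erase (Fin.last ℓ), (u i) ^ 2)
        ≤ Real.tan γ * (u (Fin.last ℓ)) ^ 2} := isClosed_le (by fun_prop) (by fun_prop)
  have h2 : IsClosed {u : EuclideanSpace ℝ (Fin (ℓ + 1)) | 0 ≤ u (Fin.last ℓ)} :=
    isClosed_le (by fun_prop) (by fun_prop)
  exact h1.inter h2

lemma coneDelta_pos (ℓ : ℕ) (γ : ℝ) (hγ : γ ∈ Set.Ioo 0 (π / 2)) :
    0 < volume (coneDelta ℓ γ ∩ Metric.closedBall 0 1) := by
  have ht : 0 < Real.tan γ := Real.tan_pos_of_pos_of_lt_pi_div_two hγ.1 hγ.2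
  let V : Set (EuclideanSpace ℝ (Fin (ℓ + 1))) :=
    ({u | (∑ i ∈ Finset.univ.erase (Fin.last ℓ), (u i) ^ 2)
        < Real.tan γ * (u (Fin.last ℓ)) ^ 2} ∩ {u | 0 < u (Fin.last ℓ)}) ∩ Metric.ball 0 1
  have hV : IsOpen V := by
    refine IsOpen.inter (IsOpen.inter ?_ ?_) Metric.isOpen_ball
    · exact isOpen_lt (by fun_prop) (by fun_prop)
    · exact isOpen_lt (by fun_prop) (by fun_prop)
  have hne : V.Nonempty := by
    refine ⟨EuclideanSpace.single (Fin.last ℓ) (1 / 2 : ℝ), ⟨?_, ?_⟩, ?_⟩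
    · simp only [Set.mem_ofPred_eq]
      rw [Finset.sum_eq_zero]
      · simp; positivity
      · intro i hi
        have := Finset.ne_of_mem_erase hi
        simp [this]
    · simp
    · simp; norm_num
  refine lt_of_lt_of_le (hV.measure_pos volume hne) (measure_mono ?_)
  rintro u ⟨⟨h1, h2⟩, h3⟩
  exact ⟨⟨le_of_lt h1, le_of_lt h2⟩, Metric.ball_subset_closedBall h3⟩

lemma coneDelta_smul (ℓ : ℕ) (γ r : ℝ) (hr : 0 < r) {u : EuclideanSpace ℝ (Fin (ℓ + 1))}
    (hu : u ∈ coneDelta ℓ γ) : r • u ∈ coneDelta ℓ γ := by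
  obtain ⟨h1, h2⟩ := hu
  refine ⟨?_, ?_⟩
  · simp only [PiLp.smul_apply, smul_eq_mul, mul_pow]
    rw [← Finset.mul_sum]
    nlinarith [mul_le_mul_of_nonneg_left h1 (sq_nonneg r)]
  · simp only [PiLp.smul_apply, smul_eq_mul]
    positivity

lemma coneDelta_volume (ℓ : ℕ) (γ r : ℝ) (hr : 0 < r) :
    ENNReal.ofReal (r ^ (ℓ + 1)) * volume (coneDelta ℓ γ ∩ Metric.closedBall 0 1)
      ≤ volume (coneDelta ℓ γ ∩ Metric.closedBall 0 r) := by
  have h := Measure.addHaar_smul (volume : Measure (EuclideanSpace ℝ (Fin (ℓ + 1)))) r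
    (coneDelta ℓ γ ∩ Metric.closedBall 0 1)
  rw [finrank_euclideanSpace_fin, abs_of_pos (by positivity)] at h
  rw [← h]
  apply measure_mono
  rintro _ ⟨u, ⟨hu, hb⟩, rfl⟩
  refine ⟨coneDelta_smul ℓ γ r hr hu, ?_⟩
  simp only [mem_closedBall_zero_iff] at hb ⊢
  simp only [norm_smul, Real.norm_eq_abs, abs_of_pos hr]
  nlinarith

/-- Quantitative Laplace bounds under the cone condition: for a Lipschitz `g` with constant
`L`, any `λ > 0` and any `0 < r ≤ ζ`,
`max_U g − L r + λ ln(c r^{ℓ+1}) ≤ λ ln ∫_U exp(g/λ) ≤ max_U g + λ ln Leb(U)`,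
where `c := Leb(Δ_γ ∩ B_1(0))` (the ambient dimension is `ℓ + 1 ≥ 1`). -/
theorem laplace_quantitative_bounds
    (ℓ : ℕ) (U : Set (EuclideanSpace ℝ (Fin (ℓ + 1))))
    (hUcomp : IsCompact U) (hUpos : 0 < volume U)
    (ζ γ : ℝ) (hζ : 0 < ζ) (hγ : γ ∈ Set.Ioo 0 (π / 2))
    (hcone : UniformInnerCone ℓ U ζ γ)
    (c : ℝ) (hc : c = (volume (coneDelta ℓ γ ∩ Metric.closedBall 0 1)).toReal)
    (g : EuclideanSpace ℝ (Fin (ℓ + 1)) → ℝ)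
    (L : ℝ) (hL : 0 ≤ L) (hg : LipschitzOnWith (Real.toNNReal L) g U)
    (lam : ℝ) (hlam : 0 < lam)
    (r : ℝ) (hr0 : 0 < r) (hrζ : r ≤ ζ) :
    sSup (g '' U) - L * r + lam * Real.log (c * r ^ (ℓ + 1))
        ≤ lam * Real.log (∫ a in U, Real.exp (g a / lam)) ∧
      lam * Real.log (∫ a in U, Real.exp (g a / lam))
        ≤ sSup (g '' U) + lam * Real.log (volume U).toReal := by
  have hUne : U.Nonempty := nonempty_of_measure_ne_zero hUpos.ne'
  have hgc : ContinuousOn g U := hg.continuousOn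
  obtain ⟨a, haU, ha⟩ := hUcomp.exists_isMaxOn hUne hgc
  have hmax : ∀ x ∈ U, g x ≤ g a := fun x hx => ha hx
  have hsup : sSup (g '' U) = g a := by
    apply IsGreatest.csSup_eq
    refine ⟨⟨a, haU, rfl⟩, ?_⟩
    rintro _ ⟨x, hx, rfl⟩
    exact hmax x hx
  rw [hsup]
  have hUfin : volume U ≠ ⊤ := hUcomp.measure_lt_top.ne
  have hUmeas : MeasurableSet U := hUcomp.measurableSet
  have hUr : 0 < (volume U).toReal := ENNReal.toReal_pos hUpos.ne' hUfin
  have hint : IntegrableOn (fun x => Real.exp (g x / lam)) U :=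
    ContinuousOn.integrableOn_compact hUcomp (by fun_prop)
  obtain ⟨O, hO⟩ := hcone a haU
  set S := coneDelta ℓ γ ∩ Metric.closedBall (0 : EuclideanSpace ℝ (Fin (ℓ + 1))) r with hS
  have hScomp : IsCompact S :=
    (isCompact_closedBall _ _).inter_left (coneDelta_isClosed ℓ γ)
  set T := (fun u => a + O u) '' S with hT
  have hTcomp : IsCompact T := hScomp.image (by fun_prop)
  have hTU : T ⊆ U := by
    refine subset_trans (Set.image_mono ?_) hO
    exact Set.inter_subset_inter_right _ (Metric.closedBall_subset_closedBall hrζ)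
  have hTvol : volume T = volume S := by
    have h1 : T = (fun x => a + x) '' (O '' S) := by
      rw [hT, Set.image_image]
    have h2 : O '' S = O.symm ⁻¹' S := by
      ext x
      constructor
      · rintro ⟨y, hy, rfl⟩
        simpa using hy
      · intro hx
        exact ⟨O.symm x, hx, by simp⟩
    rw [h1, Set.image_add_left, measure_preimage_add, h2]
    exact O.symm.measurePreserving.measure_preimage hScomp.measurableSet.nullMeasurableSet
  have hTfin : volume T ≠ ⊤ := hTcomp.measure_lt_top.ne
  have hball : volume (coneDelta ℓ γ ∩ Metric.closedBall (0 : EuclideanSpace ℝ (Fin (ℓ + 1))) 1)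
      ≠ ⊤ :=
    ((isCompact_closedBall _ _).inter_left (coneDelta_isClosed ℓ γ)).measure_lt_top.ne
  have hcpos : 0 < c := by
    rw [hc]
    exact ENNReal.toReal_pos (coneDelta_pos ℓ γ hγ).ne' hball
  have hcT : c * r ^ (ℓ + 1) ≤ (volume T).toReal := by
    have h := ENNReal.toReal_mono hTfin ((coneDelta_volume ℓ γ r hr0).trans_eq hTvol.symm)
    rw [ENNReal.toReal_mul, ENNReal.toReal_ofReal (by positivity), ← hc] at h
    linarith
  have hTbound : ∀ x ∈ T, g a - L * r ≤ g x := by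
    intro x hx
    have hxU := hTU hx
    have hd := hg.dist_le_mul a haU x hxU
    rw [Real.coe_toNNReal L hL] at hd
    have hxr : dist a x ≤ r := by
      obtain ⟨u, hu, rfl⟩ := hx
      have := hu.2
      simpa using this
    have h3 := mul_le_mul_of_nonneg_left hxr hL
    have h4 := le_abs_self (g a - g x)
    rw [← Real.dist_eq] at h4
    linarith
  have hlow : c * r ^ (ℓ + 1) * Real.exp ((g a - L * r) / lam)
      ≤ ∫ x in U, Real.exp (g x / lam) := by
    calc c * r ^ (ℓ + 1) * Real.exp ((g a - L * r) / lam)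
        ≤ (volume T).toReal * Real.exp ((g a - L * r) / lam) := by gcongr
      _ = ∫ x in T, Real.exp ((g a - L * r) / lam) := by
          rw [setIntegral_const, smul_eq_mul, Measure.real]
      _ ≤ ∫ x in T, Real.exp (g x / lam) := by
          refine setIntegral_mono_on (integrableOn_const hTfin) (hint.mono_set hTU)
            hTcomp.measurableSet ?_
          intro x hx
          have := hTbound x hx
          gcongr
      _ ≤ ∫ x in U, Real.exp (g x / lam) := by
          refine setIntegral_mono_set hint ?_ hTU.eventuallyLE
          exact Filter.Eventually.of_forall fun x => (Real.exp_pos _).le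
  have hup : ∫ x in U, Real.exp (g x / lam) ≤ (volume U).toReal * Real.exp (g a / lam) := by
    calc ∫ x in U, Real.exp (g x / lam) ≤ ∫ x in U, Real.exp (g a / lam) := by
          refine setIntegral_mono_on hint (integrableOn_const hUfin) hUmeas ?_
          intro x hx
          have := hmax x hx
          gcongr
      _ = _ := by rw [setIntegral_const, smul_eq_mul, Measure.real]
  have hlpos : 0 < c * r ^ (ℓ + 1) := by positivity
  have hlpos' : 0 < c * r ^ (ℓ + 1) * Real.exp ((g a - L * r) / lam) := by positivity
  constructor
  · have h := Real.log_le_log hlpos' hlow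
    rw [Real.log_mul hlpos.ne' (Real.exp_pos _).ne', Real.log_exp] at h
    have h' := mul_le_mul_of_nonneg_left h hlam.le
    rw [mul_add, mul_div_cancel₀ _ hlam.ne'] at h'
    linarith
  · have h := Real.log_le_log (hlpos'.trans_le hlow) hup
    rw [Real.log_mul hUr.ne' (Real.exp_pos _).ne', Real.log_exp] at h
    have h' := mul_le_mul_of_nonneg_left h hlam.le
    rw [mul_add, mul_div_cancel₀ _ hlam.ne'] at h'
    linarith
end

section
/- (Laplace principle under the cone condition.) Let U ⊂ ℝ^ℓ be compact with Leb(U) > 0, satisfying the uniform inner-cone condition with parameters ζ > 0 and γ ∈ (0, π/2), and let g : U → ℝ be continuous. Then lim_{λ→0+} λ · ln( ∫_U exp(g(a)/λ) da ) = max_{a∈U} g(a). -/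
open MeasureTheory Real Filter

/-- The cone condition gives a nonempty open subset of `U` close to each point. -/
theorem exists_open_near (ℓ : ℕ) (U : Set (EuclideanSpace ℝ (Fin (ℓ + 1))))
    (ζ γ : ℝ) (hζ : 0 < ζ) (hγ : γ ∈ Set.Ioo 0 (π / 2))
    (hcone : UniformInnerCone ℓ U ζ γ) (a : EuclideanSpace ℝ (Fin (ℓ + 1))) (ha : a ∈ U)
    (δ : ℝ) (hδ : 0 < δ) :
    ∃ V : Set (EuclideanSpace ℝ (Fin (ℓ + 1))), IsOpen V ∧ V.Nonempty ∧ V ⊆ U ∧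
      V ⊆ Metric.ball a δ := by
  obtain ⟨O, hO⟩ := hcone a ha
  have htan : 0 < Real.tan γ := Real.tan_pos_of_pos_of_lt_pi_div_two hγ.1 hγ.2
  set r := min ζ δ with hr
  have hr0 : 0 < r := lt_min hζ hδ
  let W : Set (EuclideanSpace ℝ (Fin (ℓ + 1))) :=
    {u | (∑ i ∈ Finset.univ.erase (Fin.last ℓ), (u i) ^ 2)
        < Real.tan γ * (u (Fin.last ℓ)) ^ 2 ∧ 0 < u (Fin.last ℓ) ∧ ‖u‖ < r}
  have hW : IsOpen W := by
    refine IsOpen.and (isOpen_lt (by fun_prop) (by fun_prop)) (IsOpen.and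
      (isOpen_lt (by fun_prop) (by fun_prop)) (isOpen_lt (by fun_prop) (by fun_prop)))
  let e := O.toHomeomorph.trans (Homeomorph.addLeft a)
  have he : ∀ u, e u = a + O u := fun u => rfl
  refine ⟨e '' W, e.isOpenMap W hW, ?_, ?_, ?_⟩
  · refine Set.Nonempty.image _ ⟨EuclideanSpace.single (Fin.last ℓ) (r / 2), ?_, ?_, ?_⟩
    · rw [Finset.sum_eq_zero]
      · simp; positivity
      · intro i hi
        have := Finset.ne_of_mem_erase hi
        simp [this]
    · simp; positivity
    · simp [abs_of_pos hr0]; exact hr0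
  · rintro _ ⟨u, ⟨h1, h2, h3⟩, rfl⟩
    refine hO ⟨u, ⟨⟨h1.le, h2.le⟩, ?_⟩, rfl⟩
    simpa using h3.le.trans (min_le_left _ _)
  · rintro _ ⟨u, ⟨h1, h2, h3⟩, rfl⟩
    simpa [he] using h3.trans_le (min_le_right _ _)

/-- Laplace principle under the cone condition: for continuous `g` on compact `U`,
`λ ln ∫_U exp(g/λ) → max_{a∈U} g(a)` as `λ → 0⁺` (the ambient dimension is `ℓ + 1 ≥ 1`). -/
theorem laplace_principle
    (ℓ : ℕ) (U : Set (EuclideanSpace ℝ (Fin (ℓ + 1))))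
    (hUcomp : IsCompact U) (hUpos : 0 < volume U)
    (ζ γ : ℝ) (hζ : 0 < ζ) (hγ : γ ∈ Set.Ioo 0 (π / 2))
    (hcone : UniformInnerCone ℓ U ζ γ)
    (g : EuclideanSpace ℝ (Fin (ℓ + 1)) → ℝ) (hg : ContinuousOn g U) :
    Tendsto (fun lam : ℝ => lam * Real.log (∫ a in U, Real.exp (g a / lam)))
      (nhdsWithin 0 (Set.Ioi 0)) (nhds (sSup (g '' U))) := by
  have hne : U.Nonempty := nonempty_of_measure_ne_zero hUpos.ne'
  obtain ⟨a, haU, hsup, hmax⟩ := hUcomp.exists_sSup_image_eq_and_ge hne hg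
  rw [hsup]
  have hUfin : volume U ≠ ⊤ := hUcomp.measure_lt_top.ne
  have hUr : 0 < volume.real U := ENNReal.toReal_pos hUpos.ne' hUfin
  have hint : ∀ lam : ℝ, IntegrableOn (fun x => Real.exp (g x / lam)) U := fun lam =>
    (ContinuousOn.rexp (hg.div_const lam)).integrableOn_compact hUcomp
  have hupper : ∀ lam : ℝ, 0 < lam →
      ∫ x in U, Real.exp (g x / lam) ≤ volume.real U * Real.exp (g a / lam) := by
    intro lam hl
    have h := setIntegral_mono_on (hint lam) (integrableOn_const hUfin (C := Real.exp (g a / lam)))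
      hUcomp.measurableSet (fun x hx => by
        have := hmax x hx
        gcongr)
    simpa using h
  have hlower : ∀ ε : ℝ, 0 < ε → ∃ m : ℝ, 0 < m ∧ ∀ lam : ℝ, 0 < lam →
      m * Real.exp ((g a - ε) / lam) ≤ ∫ x in U, Real.exp (g x / lam) := by
    intro ε hε
    obtain ⟨δ, hδ, hd⟩ := Metric.continuousOn_iff.1 hg a haU ε hε
    obtain ⟨V, hVo, hVn, hVU, hVb⟩ := exists_open_near ℓ U ζ γ hζ hγ hcone a haU δ hδ
    have hVfin : volume V ≠ ⊤ := measure_ne_top_of_subset hVU hUfin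
    refine ⟨volume.real V, ENNReal.toReal_pos (hVo.measure_pos volume hVn).ne' hVfin, ?_⟩
    intro lam hl
    have h := setIntegral_mono_on (integrableOn_const hVfin (C := Real.exp ((g a - ε) / lam)))
      ((hint lam).mono_set hVU) hVo.measurableSet (fun x hx => by
        have h1 := hd x (hVU hx) (hVb hx)
        rw [Real.dist_eq] at h1
        have h2 : g a - ε ≤ g x := by linarith [(abs_lt.1 h1).1]
        gcongr)
    have h' := setIntegral_mono_set (hint lam)
      (Eventually.of_forall fun x => (Real.exp_pos _).le) hVU.eventuallyLE
    refine le_trans ?_ (h.trans h')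
    simp
  have hlim : ∀ c d : ℝ, Tendsto (fun lam : ℝ => lam * c + d) (nhdsWithin 0 (Set.Ioi 0))
      (nhds d) := by
    intro c d
    have : Tendsto (fun lam : ℝ => lam * c + d) (nhds 0) (nhds (0 * c + d)) :=
      Continuous.tendsto (by fun_prop) 0
    simp only [zero_mul, zero_add] at this
    exact this.mono_left nhdsWithin_le_nhds
  have hlog : ∀ m c lam : ℝ, 0 < m → 0 < lam →
      lam * Real.log (m * Real.exp (c / lam)) = lam * Real.log m + c := by
    intro m c lam hm hl
    rw [Real.log_mul hm.ne' (Real.exp_pos _).ne', Real.log_exp]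
    field_simp
  refine tendsto_order.2 ⟨fun b hb => ?_, fun b hb => ?_⟩
  · obtain ⟨m, hm, hml⟩ := hlower ((g a - b) / 2) (by linarith)
    have h1 := (hlim (Real.log m) (g a - (g a - b) / 2)).eventually_const_lt
      (show b < _ by linarith)
    filter_upwards [h1, self_mem_nhdsWithin] with lam h2 hl
    have hl : 0 < lam := hl
    refine h2.trans_le ?_
    rw [← hlog _ _ _ hm hl]
    have := hml lam hl
    have hp : 0 < m * Real.exp ((g a - (g a - b) / 2) / lam) := by positivity
    gcongr
  · have h1 := (hlim (Real.log (volume.real U)) (g a)).eventually_lt_const hb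
    obtain ⟨m, hm, hml⟩ := hlower 1 one_pos
    filter_upwards [h1, self_mem_nhdsWithin] with lam h2 hl
    have hl : 0 < lam := hl
    refine lt_of_le_of_lt ?_ h2
    rw [← hlog _ _ _ hUr hl]
    have := hupper lam hl
    have hp : 0 < ∫ x in U, Real.exp (g x / lam) := lt_of_lt_of_le (by positivity) (hml lam hl)
    gcongr
end

section
/- (Sequential Laplace principle, as asserted in the proof of the paper's Theorem 12.) Let U ⊂ ℝ^ℓ be compact with Leb(U) > 0, satisfying the uniform inner-cone condition with parameters ζ > 0 and γ ∈ (0, π/2). Let (gₙ)_{n∈ℕ} be a sequence of continuous functions U → ℝ that is equicontinuous and converges pointwise to a function g_∞ : U → ℝ, and let (λₙ)_{n∈ℕ} be positive reals with λₙ → 0. Then lim_{n→∞} λₙ · ln( ∫_U exp(gₙ(a)/λₙ) da ) = max_{a∈U} g_∞(a). -/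
open MeasureTheory Real Filter

/-- Small neighbourhoods of a point of `U` meet `U` in positive volume. -/
lemma inner_cone_volume_pos (ℓ : ℕ) (U : Set (EuclideanSpace ℝ (Fin (ℓ + 1))))
    (ζ γ : ℝ) (hζ : 0 < ζ) (hγ : γ ∈ Set.Ioo 0 (π / 2))
    (hcone : UniformInnerCone ℓ U ζ γ) (a : EuclideanSpace ℝ (Fin (ℓ + 1))) (ha : a ∈ U)
    (δ : ℝ) (hδ : 0 < δ) : 0 < volume (U ∩ Metric.closedBall a δ) := by
  obtain ⟨O, hO⟩ := hcone a ha
  have htan : 0 < Real.tan γ := Real.tan_pos_of_pos_of_lt_pi_div_two hγ.1 hγ.2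
  set r := min ζ δ with hr
  have hr0 : 0 < r := lt_min hζ hδ
  let V : Set (EuclideanSpace ℝ (Fin (ℓ + 1))) :=
    {u | (∑ i ∈ Finset.univ.erase (Fin.last ℓ), (u i) ^ 2)
        < Real.tan γ * (u (Fin.last ℓ)) ^ 2} ∩ {u | 0 < u (Fin.last ℓ)} ∩ Metric.ball 0 r
  have hVo : IsOpen V := by
    refine IsOpen.inter (IsOpen.inter ?_ ?_) Metric.isOpen_ball
    · exact isOpen_lt (by fun_prop) (by fun_prop)
    · exact isOpen_lt (by fun_prop) (by fun_prop)
  have hVn : V.Nonempty := by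
    refine ⟨EuclideanSpace.single (Fin.last ℓ) (r / 2), ⟨?_, ?_⟩, ?_⟩
    · have h0 : (∑ i ∈ Finset.univ.erase (Fin.last ℓ),
          ((EuclideanSpace.single (Fin.last ℓ) (r / 2) : EuclideanSpace ℝ (Fin (ℓ + 1))) i) ^ 2)
          = 0 := by
        refine Finset.sum_eq_zero fun i hi => ?_
        have := Finset.ne_of_mem_erase hi
        simp [this]
      simp only [Set.mem_setOf_eq]
      rw [h0]
      simp
      positivity
    · simp [hr0]
    · simp [abs_of_pos hr0, hr0]
  let e : EuclideanSpace ℝ (Fin (ℓ + 1)) ≃ₜ EuclideanSpace ℝ (Fin (ℓ + 1)) :=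
    O.toHomeomorph.trans (Homeomorph.addLeft a)
  have he : ∀ u, e u = a + O u := fun u => rfl
  have hpos : 0 < volume (e '' V) :=
    (e.isOpenMap V hVo).measure_pos volume (hVn.image e)
  refine hpos.trans_le (measure_mono ?_)
  rintro _ ⟨u, ⟨⟨h1, h2⟩, h3⟩, rfl⟩
  have hu : ‖u‖ < r := by simpa using h3
  refine ⟨hO ⟨u, ⟨⟨le_of_lt h1, le_of_lt h2⟩, ?_⟩, rfl⟩, ?_⟩
  · simpa using hu.le.trans (min_le_left _ _)
  · rw [he, Metric.mem_closedBall, dist_eq_norm]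
    simpa using hu.le.trans (min_le_right _ _)

/-- Sequential Laplace principle: for an equicontinuous sequence `gₙ` of continuous
functions converging pointwise to `g_∞` on `U` and `λₙ → 0⁺`,
`λₙ ln ∫_U exp(gₙ/λₙ) → max_{a∈U} g_∞(a)` (the ambient dimension is `ℓ + 1 ≥ 1`). -/
theorem laplace_principle_sequential
    (ℓ : ℕ) (U : Set (EuclideanSpace ℝ (Fin (ℓ + 1))))
    (hUcomp : IsCompact U) (hUpos : 0 < volume U)
    (ζ γ : ℝ) (hζ : 0 < ζ) (hγ : γ ∈ Set.Ioo 0 (π / 2))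
    (hcone : UniformInnerCone ℓ U ζ γ)
    (g : ℕ → EuclideanSpace ℝ (Fin (ℓ + 1)) → ℝ)
    (hgcont : ∀ n, ContinuousOn (g n) U)
    (hequi : ∀ ε : ℝ, 0 < ε → ∃ δ : ℝ, 0 < δ ∧
      ∀ n : ℕ, ∀ a ∈ U, ∀ a' ∈ U, dist a a' ≤ δ → |g n a - g n a'| ≤ ε)
    (gInf : EuclideanSpace ℝ (Fin (ℓ + 1)) → ℝ)
    (hptwise : ∀ a ∈ U, Tendsto (fun n => g n a) atTop (nhds (gInf a)))
    (lam : ℕ → ℝ) (hlampos : ∀ n, 0 < lam n)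
    (hlamlim : Tendsto lam atTop (nhds 0)) :
    Tendsto (fun n => lam n * Real.log (∫ a in U, Real.exp (g n a / lam n)))
      atTop (nhds (sSup (gInf '' U))) := by
  classical
  have hUm : MeasurableSet U := hUcomp.measurableSet
  have hUfin : volume U < ⊤ := hUcomp.measure_lt_top
  have hUne : U.Nonempty := by
    by_contra h
    rw [Set.not_nonempty_iff_eq_empty] at h
    simp [h] at hUpos
  have hequiInf : ∀ ε : ℝ, 0 < ε → ∃ δ : ℝ, 0 < δ ∧
      ∀ a ∈ U, ∀ a' ∈ U, dist a a' ≤ δ → |gInf a - gInf a'| ≤ ε := by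
    intro ε hε
    obtain ⟨δ, hδ, h⟩ := hequi ε hε
    refine ⟨δ, hδ, fun a ha a' ha' hd => ?_⟩
    exact le_of_tendsto ((hptwise a ha).sub (hptwise a' ha')).abs
      (Eventually.of_forall fun n => h n a ha a' ha' hd)
  have hcInf : ContinuousOn gInf U := by
    rw [Metric.continuousOn_iff]
    intro b hb ε hε
    obtain ⟨δ, hδ, h⟩ := hequiInf (ε / 2) (by positivity)
    refine ⟨δ, hδ, fun a ha hd => ?_⟩
    rw [Real.dist_eq]
    linarith [h a ha b hb hd.le]
  have hbdd : BddAbove (gInf '' U) := hUcomp.bddAbove_image hcInf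
  set M := sSup (gInf '' U) with hM
  have hleM : ∀ a ∈ U, gInf a ≤ M := fun a ha => le_csSup hbdd ⟨a, ha, rfl⟩
  obtain ⟨a₀, ha₀, hmax⟩ := hUcomp.exists_sSup_image_eq hUne hcInf
  have hInt : ∀ n, IntegrableOn (fun a => Real.exp (g n a / lam n)) U volume := fun n =>
    (Real.continuous_exp.comp_continuousOn ((hgcont n).div_const _)).integrableOn_compact hUcomp
  have hlogc : ∀ c : ℝ, Tendsto (fun n => lam n * Real.log c) atTop (nhds 0) := by
    intro c
    simpa using hlamlim.mul_const (Real.log c)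
  -- lower bound
  have key : ∀ n, ∀ S ⊆ U, MeasurableSet S → 0 < volume S → ∀ m : ℝ, (∀ a ∈ S, m ≤ g n a) →
      lam n * Real.log (volume.real S) + m
        ≤ lam n * Real.log (∫ a in U, Real.exp (g n a / lam n)) := by
    intro n S hSU hSm hSpos m hm
    have hl := hlampos n
    have hSfin : volume S < ⊤ := (measure_mono hSU).trans_lt hUfin
    have hc : 0 < volume.real S := ENNReal.toReal_pos hSpos.ne' hSfin.ne
    have h1 : volume.real S * Real.exp (m / lam n) ≤ ∫ a in U, Real.exp (g n a / lam n) := by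
      calc volume.real S * Real.exp (m / lam n) = ∫ a in S, Real.exp (m / lam n) := by
            simp
        _ ≤ ∫ a in S, Real.exp (g n a / lam n) := by
            refine setIntegral_mono_on (integrableOn_const hSfin.ne) ((hInt n).mono_set hSU) hSm ?_
            intro a ha
            exact Real.exp_le_exp.2 (div_le_div_of_nonneg_right (hm a ha) hl.le)
        _ ≤ _ := setIntegral_mono_set (hInt n)
            (Eventually.of_forall fun a => (Real.exp_pos _).le) (HasSubset.Subset.eventuallyLE hSU)
    have h2 := Real.log_le_log (mul_pos hc (Real.exp_pos _)) h1
    rw [Real.log_mul hc.ne' (Real.exp_pos _).ne', Real.log_exp] at h2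
    have h3 := mul_le_mul_of_nonneg_left h2 hl.le
    rw [mul_add, mul_div_cancel₀ _ hl.ne'] at h3
    exact h3
  have keyU : ∀ n, ∀ m : ℝ, (∀ a ∈ U, g n a ≤ m) →
      lam n * Real.log (∫ a in U, Real.exp (g n a / lam n))
        ≤ lam n * Real.log (volume.real U) + m := by
    intro n m hm
    have hl := hlampos n
    have hc : 0 < volume.real U := ENNReal.toReal_pos hUpos.ne' hUfin.ne
    have h1 : ∫ a in U, Real.exp (g n a / lam n) ≤ volume.real U * Real.exp (m / lam n) := by
      calc ∫ a in U, Real.exp (g n a / lam n) ≤ ∫ a in U, Real.exp (m / lam n) := by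
            refine setIntegral_mono_on (hInt n) (integrableOn_const hUfin.ne) hUm ?_
            intro a ha
            exact Real.exp_le_exp.2 (div_le_div_of_nonneg_right (hm a ha) hl.le)
        _ = _ := by simp
    have h0 : 0 < ∫ a in U, Real.exp (g n a / lam n) := by
      haveI : NeZero (volume.restrict U) := ⟨by
        rw [Ne, Measure.restrict_eq_zero]; exact hUpos.ne'⟩
      exact integral_exp_pos (hInt n)
    have h2 := Real.log_le_log h0 h1
    rw [Real.log_mul hc.ne' (Real.exp_pos _).ne', Real.log_exp] at h2
    have h3 := mul_le_mul_of_nonneg_left h2 hl.le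
    rw [mul_add, mul_div_cancel₀ _ hl.ne'] at h3
    exact h3
  rw [Metric.tendsto_atTop']
  intro ε hε
  obtain ⟨δ, hδ, hd⟩ := hequi (ε / 4) (by positivity)
  have hlow : ∀ᶠ n in atTop, M - ε < lam n * Real.log (∫ a in U, Real.exp (g n a / lam n)) := by
    have hv := inner_cone_volume_pos ℓ U ζ γ hζ hγ hcone a₀ ha₀ δ hδ
    filter_upwards [(hlogc (volume.real (U ∩ Metric.closedBall a₀ δ))).eventually_const_lt
      (show -(ε / 4) < 0 by linarith),
      (hptwise a₀ ha₀).eventually_const_lt (show gInf a₀ - ε / 4 < gInf a₀ by linarith)]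
      with n h1 h2
    have h3 := key n _ Set.inter_subset_left (hUm.inter Metric.isClosed_closedBall.measurableSet)
      hv (g n a₀ - ε / 4) (fun a ha => by
        have := (abs_le.1 (hd n a ha.1 a₀ ha₀ ha.2)).1
        linarith)
    linarith
  have hup : ∀ᶠ n in atTop, lam n * Real.log (∫ a in U, Real.exp (g n a / lam n)) < M + ε := by
    obtain ⟨t, htU, htf, hcov⟩ := hUcomp.finite_cover_balls hδ
    have ht : ∀ᶠ n in atTop, ∀ x ∈ t, g n x < M + ε / 4 := by
      rw [htf.eventually_all]
      intro x hx
      exact (hptwise x (htU hx)).eventually_lt_const (by linarith [hleM x (htU hx)])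
    filter_upwards [(hlogc (volume.real U)).eventually_lt_const
      (show 0 < ε / 4 by linarith), ht] with n h1 h2
    have h3 := keyU n (M + ε / 2) (fun a ha => by
      obtain ⟨x, hx, hax⟩ := Set.mem_iUnion₂.1 (hcov ha)
      have := (abs_le.1 (hd n a ha x (htU hx) (le_of_lt hax))).2
      linarith [h2 x hx])
    linarith
  obtain ⟨N, hN⟩ := eventually_atTop.1 (hlow.and hup)
  refine ⟨N, fun n hn => ?_⟩
  obtain ⟨h1, h2⟩ := hN n (le_of_lt hn)
  rw [Real.dist_eq, abs_lt]
  constructor <;> linarith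
end

section
/- (Paper's Lemma 5: Hölder estimates for the Gibbs policy induced by a C¹_α potential.) Let U ⊂ ℝ^ℓ be compact with Leb(U) > 0, let α ∈ (0,1), d ≥ 1, and K₀, K₃ ≥ 1. Then there exists a constant A₀ > 0, depending only on d, α, Leb(U), K₀ and K₃, with the following property. Let b : ℝ^d × U → ℝ^d be measurable with sup_{a∈U} [ sup_{x} |b(x,a)| + sup_{0<|x−y|≤1} |b(x,a) − b(y,a)|/|x−y|^α ] ≤ K₃, and let r : [0,∞) × ℝ^d × U → ℝ be measurable with sup_{a∈U} [ sup_{t,x} |r(t,x,a)| + sup{ |r(t,x,a) − r(s,y,a)| / (|t−s| + |x−y|²)^{α/2} : 0 < |t−s| + |x−y|² ≤ 1 } ] ≤ K₀. Let λ ∈ (0,1], M ≥ 1, and let w : ℝ^d → ℝ be differentiable with sup_x |w(x)| + sup_x |∇w(x)| + [w]_{α,ℝ^d} + sup_{0<|x−y|≤1} |∇w(x) − ∇w(y)|/|x−y|^α ≤ M. Define π(x,a) := exp( (⟨b(x,a), ∇w(x)⟩ + r(0,x,a))/λ ) / ∫_U exp( (⟨b(x,a'), ∇w(x)⟩ + r(0,x,a'))/λ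 ) da'. Then: (i) ‖λ·𝓗(π(·,·))‖_{C_α(ℝ^d)} ≤ A₀ M exp(A₀M/λ), where 𝓗(π(x,·)) := −∫_U π(x,a) ln π(x,a) da; (ii) the averaged drift b^π(x) := ∫_U b(x,a)π(x,a)da satisfies sup_x |b^π(x)| + sup_{0<|x−y|≤1} |b^π(x) − b^π(y)|/|x−y|^α ≤ (A₀M/λ)exp(A₀M/λ); (iii) the averaged reward r^π(t,x) := ∫_U r(t,x,a)π(x,a)da satisfies sup_{t,x} |r^π(t,x)| + sup{ |r^π(t,x) − r^π(s,y)| / (|t−s| + |x−y|²)^{α/2} : 0 < |t−s| + |x−y|² ≤ 1 } ≤ (A₀M/λ)exp(A₀M/λ). -/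
open MeasureTheory Real
open scoped RealInnerProductSpace

section GibbsAux

variable {Ω : Type*} [MeasurableSpace Ω] {μ : Measure Ω} [IsFiniteMeasure μ] [NeZero μ]

lemma gibbs_int {h : Ω → ℝ} {B : ℝ} (hm : Measurable h) (hB : ∀ᵐ a ∂μ, |h a| ≤ B) :
    Integrable (fun a => Real.exp (h a)) μ := by
  refine Integrable.of_bound (C := Real.exp B) hm.exp.aestronglyMeasurable ?_
  filter_upwards [hB] with a ha
  rw [Real.norm_eq_abs, abs_of_pos (Real.exp_pos _)]
  exact Real.exp_le_exp.2 (abs_le.1 ha).2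

lemma gibbs_mass_pos : 0 < μ.real Set.univ := by
  rw [measureReal_def]
  exact ENNReal.toReal_pos (by simpa using NeZero.ne μ) (measure_ne_top _ _)

lemma gibbs_Z_pos {h : Ω → ℝ} {B : ℝ} (hm : Measurable h) (hB : ∀ᵐ a ∂μ, |h a| ≤ B) :
    0 < ∫ a, Real.exp (h a) ∂μ :=
  integral_exp_pos (gibbs_int hm hB)

lemma gibbs_logZ_diff_le {h k : Ω → ℝ} {B η : ℝ} (hm : Measurable h) (hB : ∀ᵐ a ∂μ, |h a| ≤ B)
    (km : Measurable k) (kB : ∀ᵐ a ∂μ, |k a| ≤ B) (hk : ∀ᵐ a ∂μ, |h a - k a| ≤ η) :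
    Real.log (∫ a, Real.exp (h a) ∂μ) ≤ Real.log (∫ a, Real.exp (k a) ∂μ) + η := by
  have h1 : ∫ a, Real.exp (h a) ∂μ ≤ ∫ a, Real.exp η * Real.exp (k a) ∂μ := by
    refine integral_mono_ae (gibbs_int hm hB) ((gibbs_int km kB).const_mul _) ?_
    filter_upwards [hk] with a ha
    rw [← Real.exp_add]
    exact Real.exp_le_exp.2 (by linarith [(abs_le.1 ha).2])
  rw [integral_const_mul] at h1
  have h2 := Real.log_le_log (gibbs_Z_pos hm hB) h1
  rw [Real.log_mul (Real.exp_pos _).ne' (gibbs_Z_pos km kB).ne', Real.log_exp] at h2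
  linarith

lemma gibbs_logZ_diff {h k : Ω → ℝ} {B η : ℝ} (hm : Measurable h) (hB : ∀ᵐ a ∂μ, |h a| ≤ B)
    (km : Measurable k) (kB : ∀ᵐ a ∂μ, |k a| ≤ B) (hk : ∀ᵐ a ∂μ, |h a - k a| ≤ η) :
    |Real.log (∫ a, Real.exp (h a) ∂μ) - Real.log (∫ a, Real.exp (k a) ∂μ)| ≤ η := by
  have h1 := gibbs_logZ_diff_le hm hB km kB hk
  have h2 := gibbs_logZ_diff_le km kB hm hB (hk.mono fun a ha => by rwa [abs_sub_comm])
  exact abs_le.2 ⟨by linarith, by linarith⟩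

lemma gibbs_logZ_bound {h : Ω → ℝ} {B : ℝ} (hm : Measurable h) (hB : ∀ᵐ a ∂μ, |h a| ≤ B) :
    |Real.log (∫ a, Real.exp (h a) ∂μ)| ≤ |Real.log (μ.real Set.univ)| + B := by
  obtain ⟨a, ha⟩ := hB.exists
  have hB0 : 0 ≤ B := (abs_nonneg _).trans ha
  have := gibbs_logZ_diff (k := fun _ => 0) (η := B) hm hB measurable_const
    (Filter.Eventually.of_forall fun a => by simpa using hB0) (by simpa using hB)
  simp only [Real.exp_zero, integral_const, smul_eq_mul, mul_one] at this
  have h2 := abs_add_le (Real.log (∫ a, Real.exp (h a) ∂μ) - Real.log (μ.real Set.univ))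
    (Real.log (μ.real Set.univ))
  rw [sub_add_cancel] at h2
  linarith

lemma gibbs_exp_diff_s19 (x y : ℝ) :
    |Real.exp x - Real.exp y| ≤ (Real.exp x + Real.exp y) * |x - y| := by
  have key : ∀ x y : ℝ, x ≤ y → Real.exp y - Real.exp x ≤ Real.exp y * (y - x) := by
    intro x y _
    have h1 := Real.add_one_le_exp (x - y)
    have h2 : Real.exp x = Real.exp y * Real.exp (x - y) := by
      rw [← Real.exp_add]; ring_nf
    rw [h2]
    nlinarith [Real.exp_pos y]
  rcases le_total x y with h | h
  · have := key x y h
    have h3 := Real.exp_le_exp.2 h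
    rw [abs_sub_comm, abs_of_nonneg (by linarith), abs_sub_comm, abs_of_nonneg (by linarith)]
    nlinarith [Real.exp_pos x]
  · have := key y x h
    have h3 := Real.exp_le_exp.2 h
    rw [abs_of_nonneg (by linarith), abs_of_nonneg (by linarith)]
    nlinarith [Real.exp_pos y]

/-- The Gibbs density. -/
noncomputable def gibbsDens (μ : Measure Ω) (h : Ω → ℝ) (a : Ω) : ℝ :=
  Real.exp (h a) / ∫ a', Real.exp (h a') ∂μ

lemma gibbsDens_eq {h : Ω → ℝ} {B : ℝ} (hm : Measurable h) (hB : ∀ᵐ a ∂μ, |h a| ≤ B) (a : Ω) :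
    gibbsDens μ h a = Real.exp (h a - Real.log (∫ a', Real.exp (h a') ∂μ)) := by
  rw [gibbsDens, Real.exp_sub, Real.exp_log (gibbs_Z_pos hm hB)]

lemma gibbsDens_integrable {h : Ω → ℝ} {B : ℝ} (hm : Measurable h) (hB : ∀ᵐ a ∂μ, |h a| ≤ B) :
    Integrable (gibbsDens μ h) μ := (gibbs_int hm hB).div_const _

lemma gibbsDens_integral {h : Ω → ℝ} {B : ℝ} (hm : Measurable h) (hB : ∀ᵐ a ∂μ, |h a| ≤ B) :
    ∫ a, gibbsDens μ h a ∂μ = 1 := by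
  unfold gibbsDens
  rw [integral_div, div_self (gibbs_Z_pos hm hB).ne']

lemma gibbsDens_pos {h : Ω → ℝ} {B : ℝ} (hm : Measurable h) (hB : ∀ᵐ a ∂μ, |h a| ≤ B) (a : Ω) :
    0 < gibbsDens μ h a := by
  rw [gibbsDens_eq hm hB]; exact Real.exp_pos _

variable {F : Type*} [NormedAddCommGroup F] [NormedSpace ℝ F]

lemma gibbs_smul_integrable {h : Ω → ℝ} {B : ℝ} (hm : Measurable h) (hB : ∀ᵐ a ∂μ, |h a| ≤ B)
    {f : Ω → F} (fm : AEStronglyMeasurable f μ) {D : ℝ} (fD : ∀ᵐ a ∂μ, ‖f a‖ ≤ D) :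
    Integrable (fun a => gibbsDens μ h a • f a) μ := by
  have hp := gibbsDens_integrable hm hB
  refine (hp.mul_const D).mono' (hp.aestronglyMeasurable.smul fm) ?_
  filter_upwards [fD] with a ha
  have := gibbsDens_pos hm hB a
  rw [norm_smul, Real.norm_eq_abs, abs_of_pos this]
  gcongr

lemma gibbs_avg_bound {h : Ω → ℝ} {B : ℝ} (hm : Measurable h) (hB : ∀ᵐ a ∂μ, |h a| ≤ B)
    {f : Ω → F} {D : ℝ} (fD : ∀ᵐ a ∂μ, ‖f a‖ ≤ D) :
    ‖∫ a, gibbsDens μ h a • f a ∂μ‖ ≤ D := by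
  have hp := gibbsDens_integrable hm hB
  refine (norm_integral_le_of_norm_le (hp.mul_const D) ?_).trans ?_
  · filter_upwards [fD] with a ha
    have := gibbsDens_pos hm hB a
    rw [norm_smul, Real.norm_eq_abs, abs_of_pos this]
    gcongr
  · rw [integral_mul_const, gibbsDens_integral hm hB, one_mul]

lemma gibbs_avg_diff {h k : Ω → ℝ} {B η : ℝ} (hm : Measurable h) (hB : ∀ᵐ a ∂μ, |h a| ≤ B)
    (km : Measurable k) (kB : ∀ᵐ a ∂μ, |k a| ≤ B) (hk : ∀ᵐ a ∂μ, |h a - k a| ≤ η)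
    {f g : Ω → F} (fm : AEStronglyMeasurable f μ) (gm : AEStronglyMeasurable g μ) {S D : ℝ}
    (fS : ∀ᵐ a ∂μ, ‖f a‖ ≤ S) (gS : ∀ᵐ a ∂μ, ‖g a‖ ≤ S) (fg : ∀ᵐ a ∂μ, ‖f a - g a‖ ≤ D) :
    ‖(∫ a, gibbsDens μ h a • f a ∂μ) - ∫ a, gibbsDens μ k a • g a ∂μ‖ ≤ D + 4 * η * S := by
  have hp := gibbsDens_integrable hm hB
  have kp := gibbsDens_integrable km kB
  rw [← integral_sub (gibbs_smul_integrable hm hB fm fS) (gibbs_smul_integrable km kB gm gS)]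
  refine (norm_integral_le_of_norm_le
    ((hp.mul_const D).add ((hp.add kp).mul_const (2 * η * S))) ?_).trans ?_
  · filter_upwards [fS, gS, fg, hk] with a h1 h2 h3 h4
    have p1 := gibbsDens_pos hm hB a
    have p2 := gibbsDens_pos km kB a
    have hS : 0 ≤ S := (norm_nonneg _).trans h1
    have hlz := gibbs_logZ_diff hm hB km kB hk
    have e1 := gibbs_exp_diff_s19 (h a - Real.log (∫ a', Real.exp (h a') ∂μ))
      (k a - Real.log (∫ a', Real.exp (k a') ∂μ))
    rw [← gibbsDens_eq hm hB, ← gibbsDens_eq km kB] at e1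
    have e2 : |(h a - Real.log (∫ a', Real.exp (h a') ∂μ)) -
      (k a - Real.log (∫ a', Real.exp (k a') ∂μ))| ≤ 2 * η := by
      rw [abs_le] at *
      constructor <;> linarith [h4.1, h4.2, hlz.1, hlz.2]
    have e3 : |gibbsDens μ h a - gibbsDens μ k a| ≤
        (gibbsDens μ h a + gibbsDens μ k a) * (2 * η) :=
      e1.trans (mul_le_mul_of_nonneg_left e2 (by positivity))
    have e4 : gibbsDens μ h a • f a - gibbsDens μ k a • g a =
        gibbsDens μ h a • (f a - g a) + (gibbsDens μ h a - gibbsDens μ k a) • g a := by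
      rw [smul_sub, sub_smul]; abel
    rw [e4]
    refine (norm_add_le _ _).trans ?_
    rw [norm_smul, norm_smul, Real.norm_eq_abs, Real.norm_eq_abs, abs_of_pos p1]
    have := mul_le_mul e3 h2 (norm_nonneg _) ((abs_nonneg _).trans e3)
    have := mul_le_mul_of_nonneg_left h3 p1.le
    simp only [Pi.add_apply]
    linarith
  · have i1 : ∫ a, (gibbsDens μ h + gibbsDens μ k) a ∂μ =
        (∫ a, gibbsDens μ h a ∂μ) + ∫ a, gibbsDens μ k a ∂μ := integral_add hp kp
    rw [integral_add' (hp.mul_const D) ((hp.add kp).mul_const (2 * η * S)),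
      integral_mul_const, integral_mul_const, i1, gibbsDens_integral hm hB, gibbsDens_integral km kB]
    linarith

lemma gibbs_entropy_eq {h : Ω → ℝ} {B : ℝ} (hm : Measurable h) (hB : ∀ᵐ a ∂μ, |h a| ≤ B) :
    -∫ a, gibbsDens μ h a * Real.log (gibbsDens μ h a) ∂μ =
      Real.log (∫ a, Real.exp (h a) ∂μ) - ∫ a, gibbsDens μ h a • h a ∂μ := by
  have hp := gibbsDens_integrable hm hB
  have e : ∀ a, gibbsDens μ h a * Real.log (gibbsDens μ h a) =
      gibbsDens μ h a • h a - gibbsDens μ h a * Real.log (∫ a, Real.exp (h a) ∂μ) := by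
    intro a
    have : Real.log (gibbsDens μ h a) = h a - Real.log (∫ a, Real.exp (h a) ∂μ) := by
      rw [gibbsDens_eq hm hB, Real.log_exp]
    rw [this, smul_eq_mul]; ring
  simp_rw [e]
  rw [integral_sub (gibbs_smul_integrable hm hB hm.aestronglyMeasurable hB) (hp.mul_const _),
    integral_mul_const, gibbsDens_integral hm hB]
  ring

lemma gibbs_entropy_bound {h : Ω → ℝ} {B : ℝ} (hm : Measurable h) (hB : ∀ᵐ a ∂μ, |h a| ≤ B) :
    |-∫ a, gibbsDens μ h a * Real.log (gibbsDens μ h a) ∂μ| ≤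
      |Real.log (μ.real Set.univ)| + 2 * B := by
  rw [gibbs_entropy_eq hm hB]
  have h1 := gibbs_logZ_bound hm hB
  have h2 := gibbs_avg_bound (f := h) hm hB hB
  rw [Real.norm_eq_abs] at h2
  have := abs_sub (Real.log (∫ a, Real.exp (h a) ∂μ)) (∫ a, gibbsDens μ h a • h a ∂μ)
  linarith

lemma gibbs_entropy_diff {h k : Ω → ℝ} {B η : ℝ} (hm : Measurable h) (hB : ∀ᵐ a ∂μ, |h a| ≤ B)
    (km : Measurable k) (kB : ∀ᵐ a ∂μ, |k a| ≤ B) (hk : ∀ᵐ a ∂μ, |h a - k a| ≤ η) :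
    |(-∫ a, gibbsDens μ h a * Real.log (gibbsDens μ h a) ∂μ) -
      (-∫ a, gibbsDens μ k a * Real.log (gibbsDens μ k a) ∂μ)| ≤ 2 * η + 4 * η * B := by
  rw [gibbs_entropy_eq hm hB, gibbs_entropy_eq km kB]
  have h1 := gibbs_logZ_diff hm hB km kB hk
  have h2 := gibbs_avg_diff hm hB km kB hk hm.aestronglyMeasurable km.aestronglyMeasurable
    hB kB hk
  rw [Real.norm_eq_abs] at h2
  rw [abs_le] at *
  constructor <;> linarith [h1.1, h1.2, h2.1, h2.2]

end GibbsAux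

/-- Paper's Lemma 5: Hölder estimates for the Gibbs policy induced by a `C¹_α` potential.
There is a constant `A₀ > 0`, depending only on `d`, `α`, `Leb(U)`, `K₀`, `K₃`, such that
for any drift `b` and reward `r` with the stated uniform bounds and (parabolic) Hölder
bounds, any `λ ∈ (0,1]`, `M ≥ 1` and any differentiable potential `w` with
`C¹_α`-bounds at most `M`, the Gibbs policy
`π(x,a) = exp((⟨b(x,a),∇w(x)⟩ + r(0,x,a))/λ) / ∫_U exp((⟨b(x,a'),∇w(x)⟩ + r(0,x,a'))/λ)da'`
satisfies:
(i)  `‖λ 𝓗(π(·,·))‖_{C_α(ℝ^d)} ≤ A₀ M exp(A₀M/λ)`;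
(ii) `b^π(x) = ∫_U b(x,a)π(x,a)da` has sup-norm and `α`-Hölder quotient (at distance
     at most `1`) bounded by `(A₀M/λ)exp(A₀M/λ)`;
(iii) `r^π(t,x) = ∫_U r(t,x,a)π(x,a)da` has sup-norm and parabolic `α/2`-Hölder quotient
     (at parabolic distance at most `1`) bounded by `(A₀M/λ)exp(A₀M/λ)`. -/
theorem gibbs_policy_holder_estimates
    (ℓ : ℕ) (hℓ : 1 ≤ ℓ)
    (U : Set (EuclideanSpace ℝ (Fin ℓ)))
    (hUcomp : IsCompact U) (hUpos : 0 < volume U)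
    (α : ℝ) (hα : α ∈ Set.Ioo (0 : ℝ) 1)
    (d : ℕ) (hd : 1 ≤ d)
    (K₀ K₃ : ℝ) (hK₀ : 1 ≤ K₀) (hK₃ : 1 ≤ K₃) :
    ∃ A₀ : ℝ, 0 < A₀ ∧
      ∀ (b : EuclideanSpace ℝ (Fin d) → EuclideanSpace ℝ (Fin ℓ) → EuclideanSpace ℝ (Fin d)),
      Measurable (fun q : EuclideanSpace ℝ (Fin d) × EuclideanSpace ℝ (Fin ℓ) => b q.1 q.2) →
      (∀ a ∈ U, ∀ x, ‖b x a‖ ≤ K₃) →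
      (∀ a ∈ U, ∀ x y : EuclideanSpace ℝ (Fin d),
        0 < dist x y → dist x y ≤ 1 → ‖b x a - b y a‖ ≤ K₃ * dist x y ^ α) →
      ∀ (r : ℝ → EuclideanSpace ℝ (Fin d) → EuclideanSpace ℝ (Fin ℓ) → ℝ),
      Measurable (fun q : ℝ × EuclideanSpace ℝ (Fin d) × EuclideanSpace ℝ (Fin ℓ) =>
        r q.1 q.2.1 q.2.2) →
      (∀ a ∈ U, ∀ t : ℝ, 0 ≤ t → ∀ x, |r t x a| ≤ K₀) →
      (∀ a ∈ U, ∀ t s : ℝ, 0 ≤ t → 0 ≤ s → ∀ x y : EuclideanSpace ℝ (Fin d),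
        0 < |t - s| + dist x y ^ 2 → |t - s| + dist x y ^ 2 ≤ 1 →
        |r t x a - r s y a| ≤ K₀ * (|t - s| + dist x y ^ 2) ^ (α / 2)) →
      ∀ lam : ℝ, 0 < lam → lam ≤ 1 →
      ∀ M : ℝ, 1 ≤ M →
      ∀ w : EuclideanSpace ℝ (Fin d) → ℝ, Differentiable ℝ w →
      (∀ x, |w x| ≤ M) →
      (∀ x, ‖gradient w x‖ ≤ M) →
      (∀ x y : EuclideanSpace ℝ (Fin d),
        0 < dist x y → dist x y ≤ 1 → |w x - w y| ≤ M * dist x y ^ α) →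
      (∀ x y : EuclideanSpace ℝ (Fin d),
        0 < dist x y → dist x y ≤ 1 →
        ‖gradient w x - gradient w y‖ ≤ M * dist x y ^ α) →
      ∀ Pol : EuclideanSpace ℝ (Fin d) → EuclideanSpace ℝ (Fin ℓ) → ℝ,
      (Pol = fun x a =>
        Real.exp ((⟪b x a, gradient w x⟫ + r 0 x a) / lam) /
          ∫ a' in U, Real.exp ((⟪b x a', gradient w x⟫ + r 0 x a') / lam)) →
      -- (i) Hölder bound on `λ𝓗(π(x,·))`
      ((∀ x, |lam * shannonEntropy U (Pol x)| ≤ A₀ * M * Real.exp (A₀ * M / lam)) ∧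
        (∀ x y : EuclideanSpace ℝ (Fin d), 0 < dist x y → dist x y ≤ 1 →
          |lam * shannonEntropy U (Pol x) - lam * shannonEntropy U (Pol y)|
            ≤ A₀ * M * Real.exp (A₀ * M / lam) * dist x y ^ α)) ∧
      -- (ii) Hölder bound on the averaged drift `b^π`
      ((∀ x, ‖∫ a in U, Pol x a • b x a‖ ≤ (A₀ * M / lam) * Real.exp (A₀ * M / lam)) ∧
        (∀ x y : EuclideanSpace ℝ (Fin d), 0 < dist x y → dist x y ≤ 1 →
          ‖(∫ a in U, Pol x a • b x a) - ∫ a in U, Pol y a • b y a‖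
            ≤ (A₀ * M / lam) * Real.exp (A₀ * M / lam) * dist x y ^ α)) ∧
      -- (iii) parabolic Hölder bound on the averaged reward `r^π`
      ((∀ t : ℝ, 0 ≤ t → ∀ x,
          |∫ a in U, r t x a * Pol x a| ≤ (A₀ * M / lam) * Real.exp (A₀ * M / lam)) ∧
        (∀ t s : ℝ, 0 ≤ t → 0 ≤ s → ∀ x y : EuclideanSpace ℝ (Fin d),
          0 < |t - s| + dist x y ^ 2 → |t - s| + dist x y ^ 2 ≤ 1 →
          |(∫ a in U, r t x a * Pol x a) - ∫ a in U, r s y a * Pol y a|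
            ≤ (A₀ * M / lam) * Real.exp (A₀ * M / lam)
              * (|t - s| + dist x y ^ 2) ^ (α / 2))) := by
  classical
  obtain ⟨hα0, hα1⟩ := hα
  have hUm : MeasurableSet U := hUcomp.measurableSet
  have : IsFiniteMeasure (volume.restrict U) :=
    ⟨by rw [Measure.restrict_apply_univ]; exact hUcomp.measure_lt_top⟩
  have : NeZero (volume.restrict U) :=
    ⟨by rw [Ne, Measure.restrict_eq_zero]; exact hUpos.ne'⟩
  set μ : Measure (EuclideanSpace ℝ (Fin ℓ)) := volume.restrict U with hμ
  set L : ℝ := |Real.log (μ.real Set.univ)| with hL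
  have hL0 : 0 ≤ L := abs_nonneg _
  set C : ℝ := K₀ + K₃ with hC
  have hC1 : 1 ≤ C := by linarith
  set A : ℝ := L + 4 * C + 8 * C ^ 2 with hA
  have hA1 : 1 ≤ A := by nlinarith [sq_nonneg C]
  refine ⟨A, by linarith, ?_⟩
  intro b bm bB bH r rm rB rH lam hlam hlam1 M hM w hw wB gB wH gH Pol hPol
  -- abstract exponent
  set h : EuclideanSpace ℝ (Fin d) → EuclideanSpace ℝ (Fin ℓ) → ℝ :=
    fun x a => (⟪b x a, gradient w x⟫ + r 0 x a) / lam with hh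
  have hPol' : ∀ x, Pol x = gibbsDens μ (h x) := by
    intro x; rw [hPol]; rfl
  have bm' : ∀ x, Measurable (b x) := fun x => bm.comp measurable_prodMk_left
  have rm' : ∀ t x, Measurable (r t x) := fun t x =>
    rm.comp (measurable_const.prodMk (measurable_const.prodMk measurable_id))
  have hm : ∀ x, Measurable (h x) := fun x =>
    (((bm' x).inner measurable_const).add (rm' 0 x)).div_const lam
  have hB : ∀ x, ∀ᵐ a ∂μ, |h x a| ≤ C * M / lam := by
    intro x
    refine ae_restrict_of_forall_mem hUm fun a ha => ?_
    simp only [hh]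
    rw [abs_div, abs_of_pos hlam]
    gcongr
    have h1 := abs_real_inner_le_norm (b x a) (gradient w x)
    have h2 := mul_le_mul (bB a ha x) (gB x) (norm_nonneg _) (by linarith)
    have h3 := rB a ha 0 le_rfl x
    have h4 := abs_add_le ⟪b x a, gradient w x⟫ (r 0 x a)
    nlinarith
  have hD : ∀ x y, dist x y ≤ 1 → ∀ᵐ a ∂μ, |h x a - h y a| ≤ 2 * C * M * dist x y ^ α / lam := by
    intro x y hxy
    refine ae_restrict_of_forall_mem hUm fun a ha => ?_
    rcases (dist_nonneg (x := x) (y := y)).eq_or_lt with h0 | h0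
    · have : x = y := dist_eq_zero.1 h0.symm
      subst this
      simp only [sub_self, abs_zero]
      have := Real.rpow_nonneg (dist_nonneg (x := x) (y := x)) α
      positivity
    · simp only [hh]
      rw [← sub_div, abs_div, abs_of_pos hlam]
      gcongr
      set δ := dist x y ^ α with hδ
      have hδ0 : 0 ≤ δ := Real.rpow_nonneg dist_nonneg α
      have e : ⟪b x a, gradient w x⟫ + r 0 x a - (⟪b y a, gradient w y⟫ + r 0 y a) =
          ⟪b x a - b y a, gradient w x⟫ + ⟪b y a, gradient w x - gradient w y⟫
            + (r 0 x a - r 0 y a) := by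
        rw [inner_sub_left, inner_sub_right]; ring
      rw [e]
      have h1 := abs_real_inner_le_norm (b x a - b y a) (gradient w x)
      have h2 := abs_real_inner_le_norm (b y a) (gradient w x - gradient w y)
      have h3 := mul_le_mul (bH a ha x y h0 hxy) (gB x) (norm_nonneg _) (by positivity)
      have h4 := mul_le_mul (bB a ha y) (gH x y h0 hxy) (norm_nonneg _) (by linarith)
      have h5 := rH a ha 0 0 le_rfl le_rfl x y (by simp; positivity) (by
        simp; exact hxy)
      have h6 : (|(0:ℝ) - 0| + dist x y ^ 2) ^ (α / 2) = δ := by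
        rw [sub_self, abs_zero, zero_add, ← Real.rpow_natCast, ← Real.rpow_mul h0.le]
        congr 1
        push_cast; ring
      rw [h6] at h5
      have h7 := abs_add_le (⟪b x a - b y a, gradient w x⟫
        + ⟪b y a, gradient w x - gradient w y⟫) (r 0 x a - r 0 y a)
      have h8 := abs_add_le ⟪b x a - b y a, gradient w x⟫
        ⟪b y a, gradient w x - gradient w y⟫
      have h9 : K₀ * δ ≤ K₀ * δ * M := le_mul_of_one_le_right (by positivity) hM
      have h10 : 0 ≤ K₀ * δ * M := by positivity
      rw [hC]
      nlinarith
  have hMl : 1 ≤ M / lam := by rw [le_div_iff₀ hlam]; linarith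
  have hX1 : M / lam ≤ Real.exp (A * M / lam) := by
    have h1 := Real.add_one_le_exp (A * M / lam)
    have h2 : M / lam ≤ A * M / lam := by
      rw [mul_div_assoc]; exact le_mul_of_one_le_left (by linarith) hA1
    linarith
  have hX2 : 1 ≤ Real.exp (A * M / lam) := hMl.trans hX1
  have hAM : 0 ≤ A * M / lam := by positivity
  -- generic bound
  have gen0 : ∀ S, S ≤ C → S ≤ (A * M / lam) * Real.exp (A * M / lam) := by
    intro S hS
    have h1 : C ≤ A * M / lam := by
      rw [mul_div_assoc]
      nlinarith [sq_nonneg C]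
    nlinarith
  have gen1 : ∀ S δ δ', S ≤ C → 0 ≤ S → 0 ≤ δ → δ ≤ δ' →
      S * δ' + 4 * (2 * C * M * δ / lam) * S ≤
        (A * M / lam) * Real.exp (A * M / lam) * δ' := by
    intro S δ δ' hS hS0 hδ hδ'
    have hδ'0 := hδ.trans hδ'
    have h1 : 4 * (2 * C * M * δ / lam) * S ≤ 8 * C ^ 2 * (M / lam) * δ' := by
      calc 4 * (2 * C * M * δ / lam) * S = 8 * C * (M / lam) * δ * S := by ring
        _ ≤ 8 * C * (M / lam) * δ' * C := by gcongr
        _ = _ := by ring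
    have h2 : S * δ' ≤ C * (M / lam) * δ' := by
      gcongr
      exact hS.trans (le_mul_of_one_le_right (by linarith) hMl)
    have h3 : (C + 8 * C ^ 2) * ((M / lam) * δ') ≤ A * ((M / lam) * δ') := by
      gcongr
      linarith
    have h4 : (A * M / lam) * δ' ≤ (A * M / lam) * Real.exp (A * M / lam) * δ' := by
      gcongr
      exact le_mul_of_one_le_right hAM hX2
    have h5 : A * ((M / lam) * δ') = (A * M / lam) * δ' := by ring
    linarith
  refine ⟨⟨?_, ?_⟩, ⟨?_, ?_⟩, ⟨?_, ?_⟩⟩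
  · intro x
    rw [hPol' x, abs_mul, abs_of_pos hlam]
    have h1 := gibbs_entropy_bound (hm x) (hB x)
    have h2 := mul_le_mul_of_nonneg_left h1 hlam.le
    have h3 : lam * (L + 2 * (C * M / lam)) = lam * L + 2 * C * M := by
      field_simp
    have h4 : lam * L ≤ L * M := by nlinarith
    have h5 : A * M ≤ A * M * Real.exp (A * M / lam) := le_mul_of_one_le_right (by positivity) hX2
    have h6 : L * M + 2 * C * M ≤ A * M := by
      rw [← add_mul]
      gcongr
      nlinarith [sq_nonneg C]
    refine h2.trans ?_
    rw [h3]
    linarith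
  · intro x y h0 hxy
    rw [hPol' x, hPol' y, ← mul_sub, abs_mul, abs_of_pos hlam]
    have h1 := gibbs_entropy_diff (hm x) (hB x) (hm y) (hB y) (hD x y hxy)
    have h2 := mul_le_mul_of_nonneg_left h1 hlam.le
    refine h2.trans ?_
    set δ := dist x y ^ α with hδ
    have hδ0 : 0 ≤ δ := Real.rpow_nonneg dist_nonneg α
    have h3 : lam * (2 * (2 * C * M * δ / lam) + 4 * (2 * C * M * δ / lam) * (C * M / lam)) =
        4 * C * M * δ * 1 + 8 * C ^ 2 * M * δ * (M / lam) := by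
      field_simp
      ring
    rw [h3]
    calc 4 * C * M * δ * 1 + 8 * C ^ 2 * M * δ * (M / lam)
        ≤ 4 * C * M * δ * Real.exp (A * M / lam) + 8 * C ^ 2 * M * δ * Real.exp (A * M / lam) := by
          gcongr
      _ = (4 * C + 8 * C ^ 2) * (M * Real.exp (A * M / lam) * δ) := by ring
      _ ≤ A * (M * Real.exp (A * M / lam) * δ) := by
          gcongr
          linarith
      _ = _ := by ring
  · intro x
    rw [hPol' x]
    exact (gibbs_avg_bound (hm x) (hB x)
      (ae_restrict_of_forall_mem hUm fun a ha => bB a ha x)).trans (gen0 K₃ (by linarith))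
  · intro x y h0 hxy
    rw [hPol' x, hPol' y]
    exact (gibbs_avg_diff (hm x) (hB x) (hm y) (hB y) (hD x y hxy)
      (bm' x).aestronglyMeasurable (bm' y).aestronglyMeasurable
      (ae_restrict_of_forall_mem hUm fun a ha => bB a ha x)
      (ae_restrict_of_forall_mem hUm fun a ha => bB a ha y)
      (ae_restrict_of_forall_mem hUm fun a ha => bH a ha x y h0 hxy)).trans
      (gen1 K₃ _ _ (by linarith) (by linarith) (Real.rpow_nonneg dist_nonneg α) le_rfl)
  · intro t ht x
    rw [hPol' x]
    have e : ∀ a, r t x a * gibbsDens μ (h x) a = gibbsDens μ (h x) a • r t x a :=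
      fun a => mul_comm _ _
    simp_rw [e]
    exact (gibbs_avg_bound (f := r t x) (hm x) (hB x)
      (ae_restrict_of_forall_mem hUm fun a ha => rB a ha t ht x)).trans (gen0 K₀ (by linarith))
  · intro t s ht hs x y h0 h1
    rw [hPol' x, hPol' y]
    have e : ∀ t x a, r t x a * gibbsDens μ (h x) a = gibbsDens μ (h x) a • r t x a :=
      fun t x a => mul_comm _ _
    simp_rw [e]
    have hd0 : 0 ≤ dist x y := dist_nonneg
    have hxy : dist x y ≤ 1 := by nlinarith [abs_nonneg (t - s)]
    have hδ : dist x y ^ α ≤ (|t - s| + dist x y ^ 2) ^ (α / 2) := by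
      have h6 : (dist x y ^ 2) ^ (α / 2) = dist x y ^ α := by
        rw [← Real.rpow_natCast, ← Real.rpow_mul hd0]
        congr 1
        push_cast; ring
      rw [← h6]
      exact Real.rpow_le_rpow (by positivity) (by linarith [abs_nonneg (t - s)]) (by linarith)
    exact (gibbs_avg_diff (hm x) (hB x) (hm y) (hB y) (hD x y hxy)
      (rm' t x).aestronglyMeasurable (rm' s y).aestronglyMeasurable
      (ae_restrict_of_forall_mem hUm fun a ha => rB a ha t ht x)
      (ae_restrict_of_forall_mem hUm fun a ha => rB a ha s hs y)
      (ae_restrict_of_forall_mem hUm fun a ha => rH a ha t s ht hs x y h0 h1)).trans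
      (gen1 K₀ _ _ (by linarith) (by linarith) (Real.rpow_nonneg dist_nonneg α) hδ)
end
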